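/- arXiv:2504.16567 — 4 statements merged into one kernel-verified Lean document; each statement's English description precedes it below -/
import Mathlib

section
/- Let L be a first-order language with finitely many relation symbols and no function or constant symbols, and let A be a finite L-structure. Let CSP(A) := {B : B → A} and [A]_↔ := {B : A → B and B → A}. Then for 𝒞 equal to either CSP(A) or [A]_↔, the following are equivalent: (i) 𝒞 is decided by an adaptive left unbounded query algorithm over 𝔹; (ii) 𝒞 is decided by a non-adaptive left k-query algorithm over 𝔹 for some k. -/
open FirstOrder

/-- A finite `L`-structure: a nonempty finite domain `Fin card` together with an
`L`-structure on it. -/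
structure FinStruct (L : Language) where
  card : ℕ
  pos : 0 < card
  str : L.Structure (Fin card)

/-- The number of `L`-homomorphisms from `A` to `B`. -/
noncomputable def homCountL {L : Language} (A B : FinStruct L) : ℕ :=
  Nat.card (@Language.Hom L (Fin A.card) (Fin B.card) A.str B.str)

/-- There exists an `L`-homomorphism from `A` to `B`. -/
def HomExL {L : Language} (A B : FinStruct L) : Prop :=
  Nonempty (@Language.Hom L (Fin A.card) (Fin B.card) A.str B.str)

/-- `A` and `B` are isomorphic `L`-structures. -/
def IsoL {L : Language} (A B : FinStruct L) : Prop :=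
  Nonempty (@Language.Equiv L (Fin A.card) (Fin B.card) A.str B.str)
open scoped Classical in
/-- The Boolean homomorphism-existence value for `L`-structures. -/
noncomputable def homBL {L : Language} (A B : FinStruct L) : Bool :=
  if HomExL A B then true else false

/-- The computation path of an adaptive left unbounded query algorithm over 𝔹 on
finite `L`-structures: `G` maps the previous answers either to the next queried
structure or to a final verdict (`Sum.inr true` = YES, `Sum.inr false` = NO). -/
noncomputable def pathBL {L : Language} (G : List Bool → FinStruct L ⊕ Bool)
    (A : FinStruct L) : ℕ → List Bool
  | 0 => []
  | j + 1 =>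
    match G (pathBL G A j) with
    | Sum.inl F => pathBL G A j ++ [homBL F A]
    | Sum.inr _ => pathBL G A j

/-- A total adaptive left unbounded query algorithm over 𝔹 deciding the class `C`. -/
def UDecidesL {L : Language} (G : List Bool → FinStruct L ⊕ Bool)
    (C : Set (FinStruct L)) : Prop :=
  (∀ A : FinStruct L, ∃ (j : ℕ) (b : Bool), G (pathBL G A j) = Sum.inr b) ∧
  (∀ A : FinStruct L, A ∈ C ↔ ∃ j : ℕ, G (pathBL G A j) = Sum.inr true)

section helpers

variable {L : Language}

lemma homBL_eq_true {A B : FinStruct L} : homBL A B = true ↔ HomExL A B := by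
  unfold homBL; split_ifs with h <;> simp [h]

/-- Existence of a relation-preserving map. -/
def RH (X Y : Type) (SX : L.Structure X) (SY : L.Structure Y) : Prop :=
  ∃ f : X → Y, ∀ (n : ℕ) (r : L.Relations n) (x : Fin n → X),
    SX.RelMap r x → SY.RelMap r (f ∘ x)

lemma homExL_iff [L.IsRelational] (A B : FinStruct L) :
    HomExL A B ↔ RH (Fin A.card) (Fin B.card) A.str B.str := by
  constructor
  · rintro ⟨f⟩
    letI := A.str
    letI := B.str
    exact ⟨f.toFun, fun n r x h => f.map_rel' r x h⟩
  · rintro ⟨f, hf⟩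
    exact ⟨@Language.Hom.mk L _ _ A.str B.str f (fun {n} g => isEmptyElim g)
      (fun {n} r x h => hf n r x h)⟩

lemma RH.trans {X Y Z : Type} {SX : L.Structure X} {SY : L.Structure Y} {SZ : L.Structure Z}
    (h₁ : RH X Y SX SY) (h₂ : RH Y Z SY SZ) : RH X Z SX SZ := by
  obtain ⟨f, hf⟩ := h₁
  obtain ⟨g, hg⟩ := h₂
  exact ⟨g ∘ f, fun n r x h => hg n r _ (hf n r x h)⟩

lemma exists_fin [L.IsRelational] (X : Type) [Finite X] [Nonempty X] (S : L.Structure X) :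
    ∃ B : FinStruct L, RH X (Fin B.card) S B.str ∧ RH (Fin B.card) X B.str S ∧
      B.card = Nat.card X := by
  let e := Finite.equivFin X
  refine ⟨⟨Nat.card X, Nat.card_pos,
    { funMap := fun g => isEmptyElim g, RelMap := fun r x => S.RelMap r (e.symm ∘ x) }⟩,
    ⟨e, ?_⟩, ⟨e.symm, ?_⟩, rfl⟩
  · intro n r x h
    change S.RelMap r (e.symm ∘ (e ∘ x))
    have : e.symm ∘ (e ∘ x) = x := by ext i; simp
    rwa [this]
  · intro n r x h
    exact h

/-- Disjoint union of structures. -/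
def sumStr [L.IsRelational] {X Y : Type} (SX : L.Structure X) (SY : L.Structure Y) :
    L.Structure (X ⊕ Y) where
  funMap := fun g => isEmptyElim g
  RelMap := fun r z => (∃ x, z = Sum.inl ∘ x ∧ SX.RelMap r x) ∨
    (∃ y, z = Sum.inr ∘ y ∧ SY.RelMap r y)

/-- Induced substructure. -/
def subStr [L.IsRelational] {X : Type} (SX : L.Structure X) (p : X → Prop) :
    L.Structure {x // p x} where
  funMap := fun g => isEmptyElim g
  RelMap := fun r z => SX.RelMap r (fun i => (z i).1)

/-- No nullary facts. -/
def NoNull {X : Type} (S : L.Structure X) : Prop :=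
  ∀ (r : L.Relations 0) (x : Fin 0 → X), ¬ S.RelMap r x

lemma key_min [L.IsRelational] {Y : Type} (SY : L.Structure Y) (F : FinStruct L) (m : ℕ) :
    ∀ (X : Type) [Finite X] [Nonempty X] (S : L.Structure X), Nat.card X = m → NoNull S →
    RH X _ S F.str → ¬ RH X Y S SY →
    ∃ (X' : Type) (_ : Finite X') (_ : Nonempty X') (S' : L.Structure X'),
      RH X' _ S' F.str ∧ ¬ RH X' Y S' SY ∧
      ∀ (Z : Type) [Nonempty Z] (SZ : L.Structure Z), RH X' (Y ⊕ Z) S' (sumStr SY SZ) → RH X' Z S' SZ := by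
  induction m using Nat.strong_induction_on with
  | _ m ih =>
  intro X _ _ S hm hN hF hY
  by_cases hall : ∀ (Z : Type) [Nonempty Z] (SZ : L.Structure Z),
      RH X (Y ⊕ Z) S (sumStr SY SZ) → RH X Z S SZ
  · exact ⟨X, inferInstance, inferInstance, S, hF, hY, hall⟩
  push Not at hall
  obtain ⟨Z, _, SZ, ⟨f, hf⟩, hZ⟩ := hall
  have hsub : ∀ p : X → Prop, NoNull (subStr S p) ∧ RH _ _ (subStr S p) F.str := by
    intro p
    refine ⟨fun r x h => hN r _ h, RH.trans (SY := S) ⟨Subtype.val, fun n r x h => h⟩ hF⟩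
  have hlt : ∀ p : X → Prop, (∃ x, ¬ p x) → Nat.card {x // p x} < m := by
    rintro p ⟨x, hx⟩
    rw [← hm]
    have := Fintype.ofFinite X
    classical
    rw [Nat.card_eq_fintype_card, Nat.card_eq_fintype_card]
    exact Fintype.card_subtype_lt hx
  let p : X → Prop := fun x => ∃ y, f x = Sum.inl y
  have np : ∀ x, ¬ p x → ∃ z, f x = Sum.inr z := by
    intro x hx
    rcases h : f x with y | z
    · exact absurd ⟨y, h⟩ hx
    · exact ⟨z, rfl⟩
  have ex1 : ∃ x, p x := by
    by_contra hcon
    push Not at hcon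
    choose g hg using fun x => np x (hcon x)
    refine hZ ⟨g, fun n r x h => ?_⟩
    rcases hf n r x h with ⟨y, hy, hr⟩ | ⟨z, hz, hr⟩
    · cases n with
      | zero => exact absurd h (hN r x)
      | succ n =>
        have := congrFun hy 0
        simp [hg] at this
    · have : g ∘ x = z := by
        ext i
        have := congrFun hz i
        simpa [hg] using this
      rwa [this]
  have ex2 : ∃ x, ¬ p x := by
    by_contra hcon
    push Not at hcon
    choose g hg using hcon
    refine hY ⟨g, fun n r x h => ?_⟩
    rcases hf n r x h with ⟨y, hy, hr⟩ | ⟨z, hz, hr⟩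
    · have : g ∘ x = y := by
        ext i
        have := congrFun hy i
        simpa [hg] using this
      rwa [this]
    · cases n with
      | zero => exact absurd h (hN r x)
      | succ n =>
        have := congrFun hz 0
        simp [hg] at this
  by_cases h1 : RH _ Y (subStr S p) SY
  · by_cases h2 : RH _ Y (subStr S (fun x => ¬ p x)) SY
    · exfalso
      obtain ⟨a, ha⟩ := h1
      obtain ⟨b, hb⟩ := h2
      classical
      refine hY ⟨fun x => if h : p x then a ⟨x, h⟩ else b ⟨x, h⟩, fun n r x h => ?_⟩
      have hcase : (∀ i, p (x i)) ∨ (∀ i, ¬ p (x i)) := by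
        rcases hf n r x h with ⟨y, hy, hr⟩ | ⟨z, hz, hr⟩
        · exact Or.inl fun i => ⟨y i, congrFun hy i⟩
        · refine Or.inr fun i => ?_
          rintro ⟨y, hy⟩
          have := congrFun hz i
          simp [hy] at this
      rcases hcase with hc | hc
      · have := ha n r (fun i => ⟨x i, hc i⟩) h
        convert this using 1
        ext i
        simp [hc i]
      · have := hb n r (fun i => ⟨x i, hc i⟩) h
        convert this using 1
        ext i
        simp [hc i]
    · have : Nonempty {x // ¬ p x} := ⟨⟨_, ex2.choose_spec⟩⟩
      exact ih _ (hlt _ (by simpa using ex1)) _ _ rfl (hsub _).1 (hsub _).2 h2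
  · have : Nonempty {x // p x} := ⟨⟨_, ex1.choose_spec⟩⟩
    exact ih _ (hlt _ ex2) _ _ rfl (hsub _).1 (hsub _).2 h1

lemma key [L.IsRelational] (A F : FinStruct L) (h : ¬ HomExL F A) :
    ∃ F' : FinStruct L, HomExL F' F ∧ ¬ HomExL F' A ∧
      ∀ (Z : Type) [Nonempty Z] (SZ : L.Structure Z),
        RH (Fin F'.card) _ F'.str (sumStr A.str SZ) → RH (Fin F'.card) Z F'.str SZ := by
  suffices ∃ (X' : Type) (_ : Finite X') (_ : Nonempty X') (S' : L.Structure X'),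
      RH X' _ S' F.str ∧ ¬ RH X' _ S' A.str ∧
      ∀ (Z : Type) [Nonempty Z] (SZ : L.Structure Z),
        RH X' (_ ⊕ Z) S' (sumStr A.str SZ) → RH X' Z S' SZ by
    obtain ⟨X, _, _, S, h1, h2, h3⟩ := this
    obtain ⟨B, hb1, hb2, -⟩ := exists_fin X S
    refine ⟨B, (homExL_iff _ _).2 (hb2.trans h1), fun hh => h2 (hb1.trans ((homExL_iff _ _).1 hh)),
      fun Z _ SZ hz => hb2.trans (h3 Z SZ (hb1.trans hz))⟩
  rw [homExL_iff] at h
  have : Nonempty (Fin F.card) := ⟨⟨0, F.pos⟩⟩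
  by_cases hP : ∃ P : L.Relations 0, F.str.RelMap P default ∧ ¬ A.str.RelMap P default
  · obtain ⟨P, hP1, hP2⟩ := hP
    refine ⟨Unit, inferInstance, inferInstance,
      { funMap := fun g => isEmptyElim g
        RelMap := fun {n} r _ => (⟨n, r⟩ : Σ n, L.Relations n) = ⟨0, P⟩ },
      ⟨fun _ => ⟨0, F.pos⟩, ?_⟩, ?_, ?_⟩
    · intro n r x hr
      change (⟨n, r⟩ : Σ n, L.Relations n) = ⟨0, P⟩ at hr
      cases hr
      convert hP1
    · rintro ⟨f, hf⟩
      have := hf 0 P default rfl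
      apply hP2
      convert this
    · rintro Z _ SZ ⟨f, hf⟩
      rcases hf 0 P default rfl with ⟨y, hy, hr⟩ | ⟨z, hz, hr⟩
      · exact absurd (by convert hr) hP2
      · refine ⟨fun _ => Classical.arbitrary Z, ?_⟩
        intro n r x hr'
        change (⟨n, r⟩ : Σ n, L.Relations n) = ⟨0, P⟩ at hr'
        cases hr'
        convert hr
  · push Not at hP
    let S : L.Structure (Fin F.card) :=
      { funMap := fun g => isEmptyElim g
        RelMap := fun {n} r x => n ≠ 0 ∧ F.str.RelMap r x }
    refine key_min A.str F _ _ S rfl (fun r x hr => hr.1 rfl) ⟨id, fun n r x hr => hr.2⟩ ?_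
    rintro ⟨f, hf⟩
    refine h ⟨f, fun n r x hr => ?_⟩
    cases n with
    | zero =>
      have := hP r (by convert hr)
      convert this
    | succ n => exact hf _ r x ⟨by simp, hr⟩

lemma csp_lemma [L.IsRelational] (A : FinStruct L) (G : List Bool → FinStruct L ⊕ Bool) (j₀ : ℕ)
    (hA : G (pathBL G A j₀) = Sum.inr true)
    (hG : ∀ B, G (pathBL G B j₀) = Sum.inr true → HomExL B A) :
    ∃ (k : ℕ) (F : Fin k → FinStruct L) (X : Set (Fin k → Bool)),
        ∀ B : FinStruct L, HomExL B A ↔ (fun i => homBL (F i) B) ∈ X := by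
  have hex : ∀ j : Fin j₀, ∃ F' : FinStruct L, ∀ F, G (pathBL G A j) = Sum.inl F → ¬ HomExL F A →
      HomExL F' F ∧ ¬ HomExL F' A ∧
      ∀ (Z : Type) [Nonempty Z] (SZ : L.Structure Z),
        RH (Fin F'.card) _ F'.str (sumStr A.str SZ) → RH (Fin F'.card) Z F'.str SZ := by
    intro j
    by_cases h : ∃ F, G (pathBL G A j) = Sum.inl F ∧ ¬ HomExL F A
    · obtain ⟨F, h1, h2⟩ := h
      obtain ⟨F', h'⟩ := key A F h2
      refine ⟨F', fun F₁ hF₁ _ => ?_⟩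
      rw [h1] at hF₁
      cases hF₁
      exact h'
    · push Not at h
      exact ⟨A, fun F h1 h2 => absurd (h F h1) h2⟩
  choose F' hF' using hex
  refine ⟨j₀, F', {v | ∀ j : Fin j₀, ∀ F, G (pathBL G A j) = Sum.inl F → ¬ HomExL F A →
    v j = false}, fun B => ⟨?_, ?_⟩⟩
  · intro hB j F h1 h2
    by_contra hcon
    rw [Bool.not_eq_false, homBL_eq_true, homExL_iff] at hcon
    rw [homExL_iff] at hB
    exact (hF' j F h1 h2).2.1 ((homExL_iff _ _).2 (hcon.trans hB))
  · intro hB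
    have nA : Nonempty (Fin A.card) := ⟨⟨0, A.pos⟩⟩
    have nB : Nonempty (Fin B.card) := ⟨⟨0, B.pos⟩⟩
    obtain ⟨D, hD1, hD2, -⟩ := exists_fin _ (sumStr A.str B.str)
    have hAD : RH _ _ A.str D.str :=
      RH.trans (SY := sumStr A.str B.str) ⟨Sum.inl, fun n r x h => Or.inl ⟨x, rfl, h⟩⟩ hD1
    have hBD : RH _ _ B.str D.str :=
      RH.trans (SY := sumStr A.str B.str) ⟨Sum.inr, fun n r x h => Or.inr ⟨x, rfl, h⟩⟩ hD1
    have hpath : ∀ j ≤ j₀, pathBL G D j = pathBL G A j := by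
      intro j
      induction j with
      | zero => intro _; rfl
      | succ j ih =>
        intro hj
        have ih := ih (by omega)
        simp only [pathBL, ih]
        rcases hq : G (pathBL G A j) with F | b
        · have : homBL F D = homBL F A := by
            rw [Bool.eq_iff_iff, homBL_eq_true, homBL_eq_true]
            constructor
            · intro hFD
              by_contra hFA
              obtain ⟨h1, h2, h3⟩ := hF' ⟨j, hj⟩ F hq hFA
              have h4 := hB ⟨j, hj⟩ F hq hFA
              rw [homExL_iff] at hFD h1
              have h5 := h3 _ _ ((h1.trans hFD).trans hD2)
              rw [← homExL_iff, ← homBL_eq_true] at h5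
              simp [h5] at h4
            · intro hFA
              rw [homExL_iff] at hFA ⊢
              exact hFA.trans hAD
          simp [this]
        · simp
    have := hG D (by rw [hpath j₀ le_rfl, hA])
    rw [homExL_iff] at this ⊢
    exact hBD.trans this

lemma nonadaptive_to_adaptive (k : ℕ) (F : Fin k → FinStruct L) (X : Set (Fin k → Bool))
    (C : Set (FinStruct L)) (h : ∀ B : FinStruct L, B ∈ C ↔ (fun i => homBL (F i) B) ∈ X) :
    ∃ G : List Bool → FinStruct L ⊕ Bool, UDecidesL G C := by
  classical
  let G : List Bool → FinStruct L ⊕ Bool := fun l =>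
    if hl : l.length < k then Sum.inl (F ⟨l.length, hl⟩)
    else Sum.inr (decide ((fun i : Fin k => l.getD i false) ∈ X))
  let q : FinStruct L → ℕ → Bool := fun B i => if hi : i < k then homBL (F ⟨i, hi⟩) B else false
  have hp : ∀ B j, pathBL G B j = (List.range (min j k)).map (q B) := by
    intro B j
    induction j with
    | zero => simp [pathBL]
    | succ j ih =>
      simp only [pathBL, ih]
      by_cases hj : j < k
      · have e1 : min j k = j := by omega
        have e2 : min (j + 1) k = j + 1 := by omega
        simp [G, e1, e2, hj, List.range_succ, q]
      · have e1 : min j k = k := by omega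
        have e2 : min (j + 1) k = k := by omega
        simp [G, e1, e2]
  have hv : ∀ B j, k ≤ j → G (pathBL G B j) = Sum.inr (decide (B ∈ C)) := by
    intro B j hj
    rw [hp, min_eq_right hj]
    have : (fun i : Fin k => ((List.range k).map (q B)).getD i false)
        = fun i => homBL (F i) B := by
      ext i
      simp [q]
    simp only [G, List.length_map, List.length_range, lt_irrefl, dite_false, this, h]
  refine ⟨G, fun B => ⟨k, _, hv B k le_rfl⟩, fun B => ⟨fun hB => ⟨k, ?_⟩, ?_⟩⟩
  · rw [hv B k le_rfl]; simp [hB]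
  · rintro ⟨j, hj⟩
    by_cases hk : k ≤ j
    · rw [hv B j hk] at hj
      simpa using hj
    · rw [hp] at hj
      have e1 : min j k = j := by omega
      have : j < k := by omega
      simp [G, e1, this] at hj

end helpers

/-- for `C = CSP(A)` or `C = [A]_↔`, `C` is decided by an adaptive left
unbounded query algorithm over 𝔹 iff it is decided by a non-adaptive left `k`-query
algorithm over 𝔹 for some `k`. -/
theorem stmt16 (L : Language) [L.IsRelational] [Finite (Σ n, L.Relations n)]
    (A : FinStruct L) (C : Set (FinStruct L))
    (hC : C = {B : FinStruct L | HomExL B A} ∨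
          C = {B : FinStruct L | HomExL A B ∧ HomExL B A}) :
    (∃ G : List Bool → FinStruct L ⊕ Bool, UDecidesL G C) ↔
      ∃ (k : ℕ) (F : Fin k → FinStruct L) (X : Set (Fin k → Bool)),
        ∀ B : FinStruct L, B ∈ C ↔ (fun i => homBL (F i) B) ∈ X := by
  constructor
  · rintro ⟨G, ht, hd⟩
    have hAA : HomExL A A := (homExL_iff _ _).2 ⟨id, fun n r x h => h⟩
    have hAC : A ∈ C := by rcases hC with rfl | rfl <;> simp [hAA]
    have hCsub : ∀ B ∈ C, HomExL B A := by
      rcases hC with rfl | rfl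
      · exact fun B hB => hB
      · exact fun B hB => hB.2
    obtain ⟨j₀, hj₀⟩ := (hd A).1 hAC
    obtain ⟨k, F, X, hX⟩ := csp_lemma A G j₀ hj₀ fun B hB => hCsub B ((hd B).2 ⟨j₀, hB⟩)
    rcases hC with rfl | rfl
    · exact ⟨k, F, X, hX⟩
    · refine ⟨k + 1, Fin.cons A F, {v | v 0 = true ∧ (fun i : Fin k => v i.succ) ∈ X},
        fun B => ?_⟩
      simp only [Set.mem_setOf_eq, Fin.cons_zero, Fin.cons_succ, homBL_eq_true, hX B]
  · rintro ⟨k, F, X, h⟩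
    exact nonadaptive_to_adaptive k F X C h
end

section
/- A finite digraph A has an oriented cycle with non-zero net length if and only if there exists a positive integer n such that hom(A, C_n) = 0. -/
/-- A finite digraph: a number of vertices together with an edge relation on `Fin n`. -/
abbrev FinDigraph := Σ n : ℕ, (Fin n → Fin n → Prop)

/-- `f` is a homomorphism of digraphs from `A` to `B`. -/
def IsHom (A B : FinDigraph) (f : Fin A.1 → Fin B.1) : Prop :=
  ∀ a b : Fin A.1, A.2 a b → B.2 (f a) (f b)

/-- The number of homomorphisms from `A` to `B`. -/
noncomputable def homN (A B : FinDigraph) : ℕ :=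
  Nat.card {f : Fin A.1 → Fin B.1 // IsHom A B f}
/-- An oriented walk in a digraph `A`, with `len` steps: vertices `vert 0, …, vert len`
and signs `sign 0, …, sign (len-1)`, where a `true` sign is a forward edge and a
`false` sign is a backward edge. -/
structure OWalk (A : FinDigraph) where
  len : ℕ
  vert : ℕ → Fin A.1
  sign : ℕ → Bool
  valid : ∀ i < len,
    (sign i = true → A.2 (vert i) (vert (i + 1))) ∧
    (sign i = false → A.2 (vert (i + 1)) (vert i))

/-- The net length of an oriented walk: number of forward steps minus number of
backward steps. -/
def OWalk.netLength {A : FinDigraph} (W : OWalk A) : ℤ :=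
  (((Finset.range W.len).filter fun i => W.sign i = true).card : ℤ) -
  (((Finset.range W.len).filter fun i => W.sign i = false).card : ℤ)

/-- An oriented cycle: a closed oriented walk with at least one step whose vertices
(other than the repeated endpoint) are pairwise distinct. -/
def OWalk.IsCycle {A : FinDigraph} (W : OWalk A) : Prop :=
  0 < W.len ∧ W.vert W.len = W.vert 0 ∧
    ∀ i < W.len, ∀ j < W.len, W.vert i = W.vert j → i = j
/-- The directed cycle `C_n` on vertex set `ℤ/nℤ` (represented as `Fin n`),
with edges `i → i+1 (mod n)`. -/
def cycleD (n : ℕ) : FinDigraph := ⟨n, fun i j => (i.val + 1) % n = j.val⟩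
def netS (s : ℕ → Bool) (m : ℕ) : ℤ :=
  (((Finset.range m).filter fun i => s i = true).card : ℤ) -
  (((Finset.range m).filter fun i => s i = false).card : ℤ)

lemma netS_zero (s : ℕ → Bool) : netS s 0 = 0 := by simp [netS]

lemma netS_succ (s : ℕ → Bool) (m : ℕ) :
    netS s (m + 1) = netS s m + (if s m = true then 1 else -1) := by
  unfold netS
  rw [Finset.range_add_one, Finset.filter_insert, Finset.filter_insert]
  cases h : s m <;> simp <;> ring

def Stp (A : FinDigraph) (p q : Fin A.1 × ℤ) : Prop :=
  (A.2 p.1 q.1 ∧ q.2 = p.2 + 1) ∨ (A.2 q.1 p.1 ∧ q.2 = p.2 - 1)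

lemma Stp.symm {A : FinDigraph} {p q : Fin A.1 × ℤ} (h : Stp A p q) : Stp A q p := by
  rcases h with ⟨h, e⟩ | ⟨h, e⟩
  · exact Or.inr ⟨h, by omega⟩
  · exact Or.inl ⟨h, by omega⟩

def Rch (A : FinDigraph) := Relation.ReflTransGen (Stp A)

lemma Rch.symm {A : FinDigraph} {p q : Fin A.1 × ℤ} (h : Rch A p q) : Rch A q p := by
  induction h with
  | refl => exact Relation.ReflTransGen.refl
  | tail _ h ih => exact Relation.ReflTransGen.head h.symm ih

lemma Rch.shift {A : FinDigraph} {p q : Fin A.1 × ℤ} (h : Rch A p q) (c : ℤ) :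
    Rch A (p.1, p.2 + c) (q.1, q.2 + c) := by
  induction h with
  | refl => exact Relation.ReflTransGen.refl
  | tail _ h ih =>
    refine Relation.ReflTransGen.tail ih ?_
    rcases h with ⟨h, e⟩ | ⟨h, e⟩
    · exact Or.inl ⟨h, by simp only; omega⟩
    · exact Or.inr ⟨h, by simp only; omega⟩

lemma Rch.fn {A : FinDigraph} {p q : Fin A.1 × ℤ} (h : Rch A p q) :
    ∃ (n : ℕ) (f : ℕ → Fin A.1 × ℤ), f 0 = p ∧ f n = q ∧ ∀ i < n, Stp A (f i) (f (i + 1)) := by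
  induction h with
  | refl => exact ⟨0, fun _ => p, rfl, rfl, by simp⟩
  | @tail b c _ h ih =>
    obtain ⟨n, f, h0, hn, hs⟩ := ih
    refine ⟨n + 1, fun t => if t ≤ n then f t else c, by simp [h0], by simp, ?_⟩
    intro i hi
    rcases Nat.lt_or_ge i n with hlt | hge
    · have h1 : i ≤ n := hlt.le
      have h2 : i + 1 ≤ n := hlt
      simpa [h1, h2] using hs i hlt
    · have : i = n := by omega
      subst this
      simpa [hn] using h

def Bad (A : FinDigraph) (n : ℕ) : Prop :=
  ∃ f : ℕ → Fin A.1 × ℤ, (f n).1 = (f 0).1 ∧ (f n).2 ≠ (f 0).2 ∧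
    ∀ i < n, Stp A (f i) (f (i + 1))

lemma Bad.cycle {A : FinDigraph} (h : ∃ n, Bad A n) :
    ∃ W : OWalk A, W.IsCycle ∧ W.netLength ≠ 0 := by
  classical
  obtain ⟨n, ⟨f, h1, h2, hs⟩, hmin⟩ : ∃ n, Bad A n ∧ ∀ m < n, ¬ Bad A m :=
    ⟨Nat.find h, Nat.find_spec h, fun m hm => Nat.find_min h hm⟩
  have key : ∀ i j, i < j → j < n → (f i).1 = (f j).1 → False := by
    intro i j hij hj e
    by_cases e2 : (f i).2 = (f j).2
    · have ee : f i = f j := Prod.ext e e2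
      refine hmin (n - (j - i)) (by omega)
        ⟨fun t => if t ≤ i then f t else f (t + (j - i)), ?_, ?_, ?_⟩
      · have a1 : ¬ (n - (j - i) ≤ i) := by omega
        have a2 : n - (j - i) + (j - i) = n := by omega
        simp [a1, a2, h1]
      · have a1 : ¬ (n - (j - i) ≤ i) := by omega
        have a2 : n - (j - i) + (j - i) = n := by omega
        simpa [a1, a2] using h2
      · intro t ht
        rcases lt_trichotomy t i with hlt | rfl | hgt
        · have b1 : t ≤ i := by omega
          have b2 : t + 1 ≤ i := by omega
          simpa [b1, b2] using hs t (by omega)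
        · have b2 : t + 1 + (j - t) = j + 1 := by omega
          simpa [b2, ee] using hs j hj
        · have b1 : ¬ t ≤ i := by omega
          have b2 : ¬ t + 1 ≤ i := by omega
          have b3 : t + 1 + (j - i) = t + (j - i) + 1 := by omega
          simp only [b1, b2, b3, if_false]
          exact hs _ (by omega)
    · refine hmin (j - i) (by omega) ⟨fun t => f (i + t), ?_, ?_, ?_⟩
      · have a : i + (j - i) = j := by omega
        simp [a, e]
      · have a : i + (j - i) = j := by omega
        simpa [a] using fun h => e2 h.symm
      · intro t ht
        exact hs (i + t) (by omega)
  let s : ℕ → Bool := fun t => decide ((f (t + 1)).2 = (f t).2 + 1)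
  have hnet : ∀ m ≤ n, netS s m = (f m).2 - (f 0).2 := by
    intro m
    induction m with
    | zero => intro _; simp [netS_zero]
    | succ m ih =>
      intro hm
      rw [netS_succ, ih (by omega)]
      rcases hs m (by omega) with ⟨_, e⟩ | ⟨_, e⟩
      · have : s m = true := by simp [s, e]
        rw [if_pos this]; omega
      · have : ¬ s m = true := by simp only [s, decide_eq_true_eq]; omega
        rw [if_neg this]; omega
  refine ⟨⟨n, fun t => (f t).1, s, ?_⟩, ⟨?_, h1, ?_⟩, ?_⟩
  · intro i hi
    rcases hs i hi with ⟨h, e⟩ | ⟨h, e⟩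
    · exact ⟨fun _ => h, fun h' => by simp [s, e] at h'⟩
    · refine ⟨fun h' => ?_, fun _ => h⟩
      simp only [s, decide_eq_true_eq] at h'
      omega
  · rcases Nat.eq_zero_or_pos n with rfl | h
    · exact absurd rfl h2
    · exact h
  · intro i hi j hj e
    rcases lt_trichotomy i j with h | h | h
    · exact (key i j h hj e).elim
    · exact h
    · exact (key j i h hi e.symm).elim
  · have := hnet n le_rfl
    change netS s n ≠ 0
    omega

lemma exists_pot {A : FinDigraph} (H : ∀ a x y, Rch A (a, x) (a, y) → x = y) :
    ∃ φ : Fin A.1 → ℤ, ∀ a b, A.2 a b → φ b = φ a + 1 := by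
  let S : Setoid (Fin A.1) :=
    { r := fun a b => ∃ x, Rch A (a, 0) (b, x)
      iseqv := by
        refine ⟨fun a => ⟨0, Relation.ReflTransGen.refl⟩, ?_, ?_⟩
        · rintro a b ⟨x, h⟩
          exact ⟨-x, by simpa using (h.symm.shift (-x))⟩
        · rintro a b c ⟨x, h⟩ ⟨y, h'⟩
          have := h'.shift x
          simp only [zero_add] at this
          exact ⟨y + x, Relation.ReflTransGen.trans h this⟩ }
  have hr : ∀ a, ∃ x, Rch A ((Quotient.mk S a).out, 0) (a, x) := fun a =>
    Quotient.exact (s := S) (Quotient.out_eq (Quotient.mk S a))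
  choose φ hφ using hr
  refine ⟨φ, fun a b hab => ?_⟩
  have st : ∀ x, Stp A (a, x) (b, x + 1) := fun x => Or.inl ⟨hab, rfl⟩
  have e : Quotient.mk S a = Quotient.mk S b :=
    Quotient.sound (s := S) ⟨0 + 1, Relation.ReflTransGen.single (st 0)⟩
  have h1 := hφ a
  rw [e] at h1
  have h2 : Rch A _ _ := Relation.ReflTransGen.tail h1 (st (φ a))
  exact (H b _ _ (Relation.ReflTransGen.trans h2.symm (hφ b))).symm

/-- a finite digraph `A` has an oriented cycle with non-zero net length
iff `hom(A, C_n) = 0` for some positive `n`. -/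
theorem stmt17 (A : FinDigraph) :
    (∃ W : OWalk A, W.IsCycle ∧ W.netLength ≠ 0) ↔
      ∃ n : ℕ, 0 < n ∧ homN A (cycleD n) = 0 := by
  constructor
  · rintro ⟨W, ⟨_, hc, _⟩, hne⟩
    refine ⟨W.netLength.natAbs + 1, by omega, ?_⟩
    unfold homN
    rw [Nat.card_eq_zero]
    left
    refine ⟨fun ⟨f, hf⟩ => ?_⟩
    generalize hN : W.netLength.natAbs + 1 = N at f hf
    have hE : ∀ a b, A.2 a b → ((f b).val : ZMod N) = ((f a).val : ZMod N) + 1 := by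
      intro a b hab
      have h : ((f a).val + 1) % N = (f b).val := hf a b hab
      rw [← h, ZMod.natCast_mod]
      push_cast
      rfl
    have hm : ∀ m ≤ W.len, ((f (W.vert m)).val : ZMod N) =
        ((f (W.vert 0)).val : ZMod N) + ((netS W.sign m : ℤ) : ZMod N) := by
      intro m
      induction m with
      | zero => intro _; simp [netS_zero]
      | succ m ih =>
        intro hm
        have ih := ih (by omega)
        have hv := W.valid m (by omega)
        rw [netS_succ]
        cases hs : W.sign m
        · have := hE _ _ (hv.2 hs)
          rw [ih] at this
          simp only [Bool.false_eq_true, if_false]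
          push_cast
          linear_combination -this
        · have := hE _ _ (hv.1 hs)
          rw [ih] at this
          simp only [if_true]
          push_cast
          linear_combination this
    have h := hm W.len le_rfl
    rw [hc] at h
    have h0 : ((W.netLength : ℤ) : ZMod N) = 0 := by
      change ((netS W.sign W.len : ℤ) : ZMod N) = 0
      linear_combination -h
    rw [ZMod.intCast_zmod_eq_zero_iff_dvd] at h0
    exact hne (Int.eq_zero_of_abs_lt_dvd h0 (by rw [Int.abs_eq_natAbs]; omega))
  · rintro ⟨n, hn, h0⟩
    by_contra hW
    obtain ⟨φ, hφ⟩ := exists_pot (A := A) (by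
      intro a x y h
      by_contra hxy
      apply hW
      obtain ⟨n, f, e0, en, hs⟩ := h.fn
      exact Bad.cycle ⟨n, f, by simp [e0, en], by simp [e0, en]; omega, hs⟩)
    unfold homN at h0
    have hn' : (0 : ℤ) < n := by exact_mod_cast hn
    have hlt : ∀ a, (φ a % (n : ℤ)).toNat < n := by
      intro a
      have := Int.emod_lt_of_pos (φ a) hn'
      have := Int.emod_nonneg (φ a) hn'.ne'
      omega
    rw [Nat.card_eq_zero] at h0
    rcases h0 with h0 | h0
    · refine h0.false ⟨fun a => ⟨(φ a % (n : ℤ)).toNat, hlt a⟩, ?_⟩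
      intro a b hab
      change ((φ a % (n : ℤ)).toNat + 1) % n = (φ b % (n : ℤ)).toNat
      have p1 := Int.emod_nonneg (φ a) hn'.ne'
      have p2 := Int.emod_nonneg (φ b) hn'.ne'
      zify
      rw [Int.toNat_of_nonneg p1, Int.toNat_of_nonneg p2, hφ a b hab, Int.emod_add_emod]
    · exact not_finite_iff_infinite.mpr h0 (Subtype.finite)
end

section
/- The class 𝒞 of all finite digraphs that have an oriented cycle with non-zero net length is decided by an adaptive right unbounded query algorithm over 𝔹, but for every k it is not decided by any adaptive right k-query algorithm over 𝔹. -/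
/-- The Boolean homomorphism-existence value: `true` iff there is a homomorphism
from `A` to `B`. -/
noncomputable def homB (A B : FinDigraph) : Bool := decide (0 < homN A B)
/-- The computation path of an adaptive right unbounded query algorithm over 𝔹 on
input `A`: `G` maps the previous answers either to the next queried digraph or to a
final verdict (`Sum.inr true` = YES, `Sum.inr false` = NO); queries ask for the
existence of a homomorphism FROM the input TO the queried digraph. -/
noncomputable def pathBR (G : List Bool → FinDigraph ⊕ Bool) (A : FinDigraph) :
    ℕ → List Bool
  | 0 => []
  | j + 1 =>
    match G (pathBR G A j) with
    | Sum.inl F => pathBR G A j ++ [homB A F]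
    | Sum.inr _ => pathBR G A j

/-- A total adaptive right unbounded query algorithm over 𝔹 deciding the class `C`. -/
def UDecidesR (G : List Bool → FinDigraph ⊕ Bool) (C : Set FinDigraph) : Prop :=
  (∀ A : FinDigraph, ∃ (j : ℕ) (b : Bool), G (pathBR G A j) = Sum.inr b) ∧
  (∀ A : FinDigraph, A ∈ C ↔ ∃ j : ℕ, G (pathBR G A j) = Sum.inr true)

/-- The run of an adaptive right bounded query algorithm over 𝔹. -/
noncomputable def advRunBR (G : List Bool → FinDigraph) (A : FinDigraph) : ℕ → List Bool
  | 0 => []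
  | j + 1 => advRunBR G A j ++ [homB A (G (advRunBR G A j))]


theorem homB_iff (A F : FinDigraph) : homB A F = true ↔ ∃ f, IsHom A F f := by
  unfold homB homN
  rw [decide_eq_true_iff, Nat.card_pos_iff]
  constructor
  · rintro ⟨⟨f, hf⟩, _⟩
    exact ⟨f, hf⟩
  · rintro ⟨f, hf⟩
    exact ⟨⟨f, hf⟩, inferInstance⟩

def sgB (b : Bool) : ℤ := if b = true then 1 else -1

theorem net_eq (s : ℕ → Bool) (n : ℕ) :
    (((Finset.range n).filter fun i => s i = true).card : ℤ) -
    (((Finset.range n).filter fun i => s i = false).card : ℤ)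
    = ∑ i ∈ Finset.range n, sgB (s i) := by
  induction n with
  | zero => simp
  | succ n ih =>
    rw [Finset.sum_range_succ, ← ih, Finset.range_add_one, Finset.filter_insert,
      Finset.filter_insert]
    cases h : s n <;> simp [sgB] <;> ring

theorem netLength_eq {A : FinDigraph} (W : OWalk A) :
    W.netLength = ∑ i ∈ Finset.range W.len, sgB (W.sign i) := net_eq _ _

inductive RW (A : FinDigraph) : ℕ → Fin A.1 → Fin A.1 → ℤ → Prop
  | nil (u) : RW A 0 u u 0
  | fwd {n u v w d} : RW A n u v d → A.2 v w → RW A (n+1) u w (d+1)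
  | bwd {n u v w d} : RW A n u v d → A.2 w v → RW A (n+1) u w (d-1)

theorem RW.trans {A : FinDigraph} {n m u v w d e} (h1 : RW A n u v d) (h2 : RW A m v w e) :
    RW A (n+m) u w (d+e) := by
  induction h2 with
  | nil => simpa using h1
  | fwd _ hb ih => 
    have := RW.fwd (ih h1) hb
    rw [← add_assoc, ← add_assoc]
    exact this
  | bwd _ hb ih => 
    have := RW.bwd (ih h1) hb
    rw [← add_sub_assoc]
    exact this

theorem RW.symm {A : FinDigraph} {n u v d} (h1 : RW A n u v d) : RW A n v u (-d) := by
  induction h1 with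
  | nil => simpa using RW.nil _
  | fwd _ hb ih => 
    have := (RW.bwd (RW.nil _) hb).trans ih
    convert this using 1 <;> ring
  | bwd _ hb ih => 
    have := (RW.fwd (RW.nil _) hb).trans ih
    convert this using 1 <;> ring

theorem OWalk.seg {A : FinDigraph} (W : OWalk A) (i m : ℕ) (h : i + m ≤ W.len) :
    RW A m (W.vert i) (W.vert (i+m)) (∑ t ∈ Finset.range m, sgB (W.sign (i+t))) := by
  induction m with
  | zero => simpa using RW.nil _
  | succ m ih =>
    rw [Finset.sum_range_succ]
    have hv := W.valid (i+m) (by omega)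
    have ih := ih (by omega)
    cases hs : W.sign (i+m) with
    | true => exact RW.fwd ih (hv.1 hs)
    | false => exact RW.bwd ih (hv.2 hs)

theorem RW.owalk {A : FinDigraph} {n u v d} (h : RW A n u v d) :
    ∃ W : OWalk A, W.len = n ∧ W.vert 0 = u ∧ W.vert n = v ∧ W.netLength = d := by
  have key : ∀ (W : OWalk A) (n : ℕ) (w : Fin A.1) (b : Bool), W.len = n →
      ((b = true → A.2 (W.vert n) w) ∧ (b = false → A.2 w (W.vert n))) →
      ∃ W' : OWalk A, W'.len = n + 1 ∧ W'.vert 0 = W.vert 0 ∧ W'.vert (n+1) = w ∧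
        W'.netLength = W.netLength + sgB b := by
    intro W n w b hn hb
    subst hn
    let n := W.len
    refine ⟨⟨n+1, fun t => if t ≤ n then W.vert t else w,
      fun t => if t < n then W.sign t else b, ?_⟩, rfl, by simp, by simp [n], ?_⟩
    · intro i hi
      by_cases h : i < n
      · have := W.valid i (by omega)
        simpa [h, h.le, Nat.succ_le_of_lt h] using this
      · have : i = n := by omega
        subst this
        simpa using hb
    · rw [netLength_eq, netLength_eq]
      simp only [n]
      simp only [Finset.sum_range_succ, lt_irrefl, if_false]
      congr 1
      apply Finset.sum_congr rfl
      intro i hi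
      simp [Finset.mem_range.1 hi]
  induction h with
  | nil u => exact ⟨⟨0, fun _ => u, fun _ => true, by simp⟩, rfl, rfl, rfl, by simp [netLength_eq]⟩
  | fwd _ hb ih =>
    obtain ⟨W, h1, h2, h3, h4⟩ := ih
    obtain ⟨W', g1, g2, g3, g4⟩ := key W _ _ true h1 ⟨fun _ => h3 ▸ hb, by simp⟩
    exact ⟨W', g1, g2.trans h2, g3, by rw [g4, h4]; rfl⟩
  | bwd _ hb ih =>
    obtain ⟨W, h1, h2, h3, h4⟩ := ih
    obtain ⟨W', g1, g2, g3, g4⟩ := key W _ _ false h1 ⟨by simp, fun _ => h3 ▸ hb⟩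
    exact ⟨W', g1, g2.trans h2, g3, by rw [g4, h4]; rfl⟩

abbrev HasCyc (A : FinDigraph) : Prop := ∃ W : OWalk A, W.IsCycle ∧ W.netLength ≠ 0

theorem OWalk.closedRW {A : FinDigraph} (W : OWalk A) (h : W.IsCycle) :
    RW A W.len (W.vert 0) (W.vert 0) W.netLength := by
  have := W.seg 0 W.len (by omega)
  rw [netLength_eq]
  simpa [h.2.1] using this

theorem hasCyc_of_closed {A : FinDigraph} : ∀ n u d, RW A n u u d → d ≠ 0 → HasCyc A := by
  intro n
  induction n using Nat.strong_induction_on with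
  | _ n IH =>
  intro u d h hd
  obtain ⟨W, h1, h2, h3, h4⟩ := h.owalk
  by_cases hc : W.IsCycle
  · exact ⟨W, hc, h4 ▸ hd⟩
  have hpos : 0 < W.len := by
    rcases Nat.eq_zero_or_pos W.len with h0 | h0
    · exfalso; apply hd; rw [← h4, netLength_eq, h0]; simp
    · exact h0
  have : ∃ i j, i < j ∧ j < W.len ∧ W.vert i = W.vert j := by
    by_contra hne
    push Not at hne
    apply hc
    refine ⟨hpos, by rw [h1, h3, h2], ?_⟩
    intro i hi j hj hij
    rcases lt_trichotomy i j with hl | hl | hl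
    · exact absurd hij (hne i j hl hj)
    · exact hl
    · exact absurd hij.symm (hne j i hl hi)
  obtain ⟨i, j, hij, hj, hv⟩ := this
  have e1 : i + (j - i) = j := by omega
  have s1 := W.seg 0 i (by omega)
  have s2 := W.seg i (j-i) (by omega)
  have s3 := W.seg j (W.len - j) (by omega)
  have e3 : j + (W.len - j) = W.len := by omega
  rw [e1, ← hv] at s2
  rw [e3, ← hv] at s3
  have s4 := s1.trans (by simpa using s3)
  rw [h1, h3, h2] at s4
  by_contra hno
  have z2 : (∑ t ∈ Finset.range (j-i), sgB (W.sign (i+t))) = 0 := by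
    by_contra hz
    exact hno (IH _ (by omega) _ _ s2 hz)
  apply hno
  refine IH _ (by omega) _ _ s4 ?_
  rw [← h4, netLength_eq] at hd
  have a1 := Finset.sum_range_add (fun t => sgB (W.sign t)) i (j-i)
  have a2 := Finset.sum_range_add (fun t => sgB (W.sign t)) j (W.len-j)
  rw [e1] at a1
  rw [e3] at a2
  simp only [zero_add, ← h1] at *
  intro hz
  apply hd
  rw [a2, a1, z2]
  linarith

theorem exists_height {A : FinDigraph} (h : ¬ HasCyc A) :
    ∃ f : Fin A.1 → ℤ, ∀ a b, A.2 a b → f b = f a + 1 := by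
  have bal : ∀ n u d, RW A n u u d → d = 0 := by
    intro n u d hr
    by_contra hd
    exact h (hasCyc_of_closed n u d hr hd)
  let S : Setoid (Fin A.1) := ⟨fun u v => ∃ n d, RW A n u v d,
    fun u => ⟨0, 0, RW.nil u⟩, fun ⟨n, d, h⟩ => ⟨n, _, h.symm⟩,
    fun ⟨n, d, h⟩ ⟨m, e, h'⟩ => ⟨_, _, h.trans h'⟩⟩
  have hr : ∀ v : Fin A.1, ∃ n d, RW A n (Quotient.out (Quotient.mk S v)) v d :=
    fun v => Quotient.exact (Quotient.out_eq (Quotient.mk S v))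
  choose n d hnd using hr
  refine ⟨d, fun a b hab => ?_⟩
  have hq : Quotient.mk S a = Quotient.mk S b :=
    Quotient.sound ⟨_, _, RW.fwd (RW.nil a) hab⟩
  have hb := hnd b
  rw [← hq] at hb
  have := bal _ _ _ ((RW.fwd (hnd a) hab).trans hb.symm)
  linarith

def dpath (n : ℕ) : FinDigraph := ⟨n, fun a b => (b : ℕ) = a + 1⟩
def dcyc (n : ℕ) : FinDigraph := ⟨n, fun a b => (n : ℤ) ∣ ((b : ℕ) : ℤ) - ((a : ℕ) : ℤ) - 1⟩

theorem height_dvd {A : FinDigraph} (n : ℤ) (f : Fin A.1 → ℤ)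
    (hf : ∀ a b, A.2 a b → n ∣ f b - f a - 1) {m u v d} (h : RW A m u v d) :
    n ∣ f v - f u - d := by
  induction h with
  | nil => simp
  | fwd _ hb ih => 
    obtain ⟨c, hc⟩ := dvd_add ih (hf _ _ hb)
    exact ⟨c, by linear_combination hc⟩
  | bwd _ hb ih => 
    obtain ⟨c, hc⟩ := dvd_sub ih (hf _ _ hb)
    exact ⟨c, by linear_combination hc⟩

theorem hasCyc_dvd {A : FinDigraph} (n : ℤ) (f : Fin A.1 → ℤ)
    (hf : ∀ a b, A.2 a b → n ∣ f b - f a - 1) (W : OWalk A) (hW : W.IsCycle) :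
    n ∣ W.netLength := by
  have := height_dvd n f hf (W.closedRW hW)
  simpa using this

theorem not_hasCyc_of_height {A : FinDigraph} (f : Fin A.1 → ℤ)
    (hf : ∀ a b, A.2 a b → f b = f a + 1) : ¬ HasCyc A := by
  rintro ⟨W, hW, h0⟩
  apply h0
  have := hasCyc_dvd 0 f (fun a b hab => by rw [hf a b hab]; simp) W hW
  simpa using this

theorem not_hasCyc_of_dpath {A : FinDigraph} {n : ℕ} (h : homB A (dpath n) = true) :
    ¬ HasCyc A := by
  obtain ⟨f, hf⟩ := (homB_iff _ _).1 h
  refine not_hasCyc_of_height (fun a => ((f a : ℕ) : ℤ)) (fun a b hab => ?_)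
  have : (f b : ℕ) = f a + 1 := hf a b hab
  simp [this]

theorem dpath_of_not_hasCyc {A : FinDigraph} (h : ¬ HasCyc A) :
    ∃ n, homB A (dpath n) = true := by
  obtain ⟨f, hf⟩ := exists_height h
  let N : ℕ := ∑ a, (f a).natAbs
  have hN : ∀ a, (f a).natAbs ≤ N := fun a =>
    Finset.single_le_sum (f := fun a => (f a).natAbs) (fun _ _ => Nat.zero_le _) (Finset.mem_univ a)
  refine ⟨2*N+1, (homB_iff _ _).2 ⟨fun a => ⟨(f a + N).toNat, ?_⟩, ?_⟩⟩
  · have := hN a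
    show _ < 2 * N + 1
    omega
  · intro a b hab
    have := hf a b hab
    have h1 := hN a
    have h2 := hN b
    show (f b + N).toNat = (f a + N).toNat + 1
    omega

theorem dcyc_of_not_hasCyc {A : FinDigraph} (h : ¬ HasCyc A) (n : ℕ) :
    homB A (dcyc (n+1)) = true := by
  obtain ⟨f, hf⟩ := exists_height h
  have hp : (0:ℤ) < ((n+1 : ℕ) : ℤ) := by positivity
  have e : ∀ a, (((f a % ((n+1 : ℕ) : ℤ)).toNat : ℕ) : ℤ) = f a % ((n+1 : ℕ) : ℤ) :=
    fun a => Int.toNat_of_nonneg (Int.emod_nonneg _ hp.ne')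
  refine (homB_iff _ _).2 ⟨fun a => ⟨(f a % ((n+1 : ℕ) : ℤ)).toNat, ?_⟩, ?_⟩
  · have := Int.emod_lt_of_pos (f a) hp
    have := e a
    show _ < n + 1
    omega
  · intro a b hab
    show ((n+1 : ℕ) : ℤ) ∣ (((f b % ((n+1 : ℕ) : ℤ)).toNat : ℕ) : ℤ)
      - (((f a % ((n+1 : ℕ) : ℤ)).toNat : ℕ) : ℤ) - 1
    rw [e, e, hf a b hab, Int.emod_def, Int.emod_def]
    exact ⟨f a / ((n+1 : ℕ) : ℤ) - (f a + 1) / ((n+1 : ℕ) : ℤ), by ring⟩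

theorem dcyc_of_hasCyc {A : FinDigraph} (h : HasCyc A) : ∃ n, homB A (dcyc (n+1)) = false := by
  by_contra hne
  push Not at hne
  obtain ⟨W, hW, h0⟩ := h
  have hh := hne W.netLength.natAbs
  rw [Bool.ne_false_iff, homB_iff] at hh
  obtain ⟨f, hf⟩ := hh
  have := hasCyc_dvd _ (fun a => ((f a : ℕ) : ℤ)) hf W hW
  have := Int.natAbs_dvd_natAbs.2 this
  have := Nat.le_of_dvd (by omega) this
  change (W.netLength.natAbs + 1 : ℕ) ≤ _ at this
  omega

def qry (i : ℕ) : FinDigraph := if i % 2 = 0 then dpath (i/2) else dcyc (i/2+1)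

/-- The algorithm. -/
def algR (l : List Bool) : FinDigraph ⊕ Bool :=
  match l.getLast? with
  | none => Sum.inl (qry 0)
  | some b =>
    if l.length % 2 = 1 ∧ b = true then Sum.inr false
    else if l.length % 2 = 0 ∧ b = false then Sum.inr true
    else Sum.inl (qry l.length)

theorem algR_inl {l F} (h : algR l = Sum.inl F) : F = qry l.length := by
  unfold algR at h
  split at h
  · rename_i h'
    rw [List.getLast?_eq_none_iff] at h'
    subst h'
    simpa using h.symm
  · split_ifs at h
    simpa using h.symm

theorem algR_snoc (l : List Bool) (b : Bool) : algR (l ++ [b]) =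
    if l.length % 2 = 0 ∧ b = true then Sum.inr false
    else if l.length % 2 = 1 ∧ b = false then Sum.inr true
    else Sum.inl (qry (l.length+1)) := by
  unfold algR
  simp only [List.getLast?_concat, List.length_append, List.length_singleton]
  have e1 : ((l.length + 1) % 2 = 1) ↔ (l.length % 2 = 0) := by omega
  have e2 : ((l.length + 1) % 2 = 0) ↔ (l.length % 2 = 1) := by omega
  simp only [e1, e2]

theorem algR_sound (A : FinDigraph) (j : ℕ) :
    ∀ b, algR (pathBR algR A j) = Sum.inr b → (HasCyc A ↔ b = true) := by
  induction j with
  | zero => intro b hb; simp [pathBR, algR] at hb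
  | succ j ih =>
    intro b hb
    rw [pathBR] at hb
    cases hG : algR (pathBR algR A j) with
    | inr c =>
      rw [hG] at hb
      simp only at hb
      exact ih b hb
    | inl F =>
      rw [hG] at hb
      simp only at hb
      have hF := algR_inl hG
      rw [algR_snoc] at hb
      split_ifs at hb with h1 h2
      · obtain ⟨h1, h1'⟩ := h1
        rw [hF, qry, if_pos h1] at h1'
        have := not_hasCyc_of_dpath h1'
        simp at hb
        simp [this, ← hb]
      · obtain ⟨h1, h1'⟩ := h2
        rw [hF, qry, if_neg (by omega)] at h1'
        simp at hb
        simp only [← hb, iff_true]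
        by_contra hn
        rw [dcyc_of_not_hasCyc hn] at h1'
        simp at h1'

theorem algR_len (A : FinDigraph) (j : ℕ)
    (h : ∀ i < j, ∀ b, algR (pathBR algR A i) ≠ Sum.inr b) :
    (pathBR algR A j).length = j := by
  induction j with
  | zero => rfl
  | succ j ih =>
    have ih := ih (fun i hi => h i (by omega))
    rw [pathBR]
    cases hG : algR (pathBR algR A j) with
    | inr c => exact absurd hG (h j (by omega) c)
    | inl F => simp [ih]

theorem algR_total (A : FinDigraph) : ∃ j b, algR (pathBR algR A j) = Sum.inr b := by
  by_contra hne
  push Not at hne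
  have hlen : ∀ j, (pathBR algR A j).length = j := fun j => algR_len A j (fun i _ => hne i)
  have hstep : ∀ j, algR (pathBR algR A (j+1)) =
    if j % 2 = 0 ∧ homB A (qry j) = true then Sum.inr false
    else if j % 2 = 1 ∧ homB A (qry j) = false then Sum.inr true
    else Sum.inl (qry (j+1)) := by
    intro j
    rw [pathBR]
    cases hG : algR (pathBR algR A j) with
    | inr c => exact absurd hG (hne j c)
    | inl F =>
      have hF := algR_inl hG
      simp only
      rw [algR_snoc, hF, hlen]
  by_cases hA : HasCyc A
  · obtain ⟨n, hn⟩ := dcyc_of_hasCyc hA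
    have hs := hstep (2*n+1)
    have hq : qry (2*n+1) = dcyc (n+1) := by
      unfold qry; rw [if_neg (by omega)]; congr 2; omega
    rw [if_neg (by omega), hq, if_pos ⟨by omega, hn⟩] at hs
    exact hne _ _ hs
  · obtain ⟨n, hn⟩ := dpath_of_not_hasCyc hA
    have hs := hstep (2*n)
    have hq : qry (2*n) = dpath n := by
      unfold qry; rw [if_pos (by omega)]; congr 1; omega
    rw [hq, if_pos ⟨by omega, hn⟩] at hs
    exact hne _ _ hs

theorem algR_decides : UDecidesR algR {A : FinDigraph | HasCyc A} := by
  refine ⟨algR_total, fun A => ⟨fun hA => ?_, ?_⟩⟩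
  · obtain ⟨j, b, hb⟩ := algR_total A
    have : b = true := (algR_sound A j b hb).1 hA
    exact ⟨j, this ▸ hb⟩
  · rintro ⟨j, hj⟩
    exact (algR_sound A j _ hj).2 rfl

theorem not_hasCyc_dpath (n : ℕ) : ¬ HasCyc (dpath n) :=
  not_hasCyc_of_dpath ((homB_iff _ _).2 ⟨id, fun _ _ h => h⟩)

theorem hasCyc_dcyc (n : ℕ) : HasCyc (dcyc (n+1)) := by
  refine ⟨⟨n+1, fun i => ⟨i % (n+1), Nat.mod_lt _ (Nat.succ_pos n)⟩, fun _ => true, ?_⟩, ?_, ?_⟩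
  · intro i _
    refine ⟨fun _ => ?_, by simp⟩
    show ((n+1 : ℕ) : ℤ) ∣ (((i+1) % (n+1) : ℕ) : ℤ) - ((i % (n+1) : ℕ) : ℤ) - 1
    rw [Int.natCast_mod, Int.natCast_mod, Int.emod_def, Int.emod_def]
    exact ⟨(i:ℤ) / ((n+1 : ℕ) : ℤ) - ((i + 1 : ℕ) : ℤ) / ((n+1 : ℕ) : ℤ), by push_cast; ring⟩
  · refine ⟨Nat.succ_pos n, by simp, ?_⟩
    intro i hi j hj hij
    have := congrArg Fin.val hij
    simp only at this hi hj
    rwa [Nat.mod_eq_of_lt hi, Nat.mod_eq_of_lt hj] at this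
  · rw [netLength_eq]
    simp [sgB]
    omega

theorem homB_same (F : FinDigraph) (N M : ℕ) (hF : F.1 < N) (hM : N.factorial = M + 1) :
    homB (dcyc (M+1)) F = homB (dpath N) F := by
  rw [Bool.eq_iff_iff, homB_iff, homB_iff]
  constructor
  · rintro ⟨f, hf⟩
    have hNM : N ≤ M + 1 := hM ▸ Nat.self_le_factorial N
    refine ⟨fun a => f ⟨a.1, lt_of_lt_of_le a.2 hNM⟩, fun a b hab => hf _ _ ?_⟩
    have hab : (b : ℕ) = a + 1 := hab
    show ((M+1 : ℕ) : ℤ) ∣ ((b : ℕ) : ℤ) - ((a : ℕ) : ℤ) - 1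
    rw [hab]; simp
  · rintro ⟨f, hf⟩
    have hcard : ∃ x y : Fin N, x ≠ y ∧ f x = f y :=
      Fintype.exists_ne_map_eq_of_card_lt (α := Fin N) (β := Fin F.1) f (by simpa using hF)
    have : ∃ x y : Fin N, x < y ∧ f x = f y := by
      obtain ⟨x, y, hne, he⟩ := hcard
      rcases lt_or_gt_of_ne hne with h | h
      · exact ⟨x, y, h, he⟩
      · exact ⟨y, x, h, he.symm⟩
    obtain ⟨x, y, hxy, he⟩ := this
    have hxy' : (x : ℕ) < y := hxy
    obtain ⟨p, hp⟩ : ∃ p, (y : ℕ) = x + p := ⟨y - x, by omega⟩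
    have hp0 : 0 < p := by omega
    have hyN := y.2
    have hpd : p ∣ M + 1 := hM ▸ Nat.dvd_factorial hp0 (by omega)
    have hlt : ∀ a, (x : ℕ) + a % p < N := fun a => by
      have := Nat.mod_lt a hp0
      omega
    refine ⟨fun a => f ⟨x + a.1 % p, hlt a.1⟩, fun a b hab => ?_⟩
    have hab : ((M+1 : ℕ) : ℤ) ∣ ((b : ℕ) : ℤ) - ((a : ℕ) : ℤ) - 1 := hab
    have hab' : (p : ℤ) ∣ ((b : ℕ) : ℤ) - ((a + 1 : ℕ) : ℤ) := by
      obtain ⟨c, hc⟩ := dvd_trans (Int.natCast_dvd_natCast.2 hpd) hab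
      exact ⟨c, by push_cast; linear_combination hc⟩
    have hmod : (b : ℕ) % p = (a + 1) % p := 
      ((Nat.modEq_iff_dvd).2 hab').symm
    have hma := Nat.mod_lt a.1 hp0
    by_cases hc : a.1 % p + 1 < p
    · apply hf
      show (x : ℕ) + b.1 % p = x + a.1 % p + 1
      rw [hmod, Nat.add_mod, Nat.mod_eq_of_lt (a := 1) (by omega), Nat.mod_eq_of_lt hc]
      omega
    · have hap : a.1 % p + 1 = p := by omega
      have hb0 : b.1 % p = 0 := by
        rw [hmod, ← Nat.mod_add_mod, hap, Nat.mod_self]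
      have e1 : f ⟨x + b.1 % p, hlt b.1⟩ = f y := by
        rw [← he]; congr 1; apply Fin.ext; simp [hb0]
      show F.2 (f ⟨x + a.1 % p, hlt a.1⟩) (f ⟨x + b.1 % p, hlt b.1⟩)
      rw [e1]
      apply hf
      show (y : ℕ) = x + a.1 % p + 1
      omega

theorem exists_bound (k : ℕ) (G : List Bool → FinDigraph) :
    ∃ N, ∀ l : List Bool, l.length < k → (G l).1 < N := by
  have hfin : Set.Finite {l : List Bool | l.length < k} := List.finite_length_lt Bool k
  obtain ⟨N, hN⟩ := (hfin.image fun l => (G l).1).bddAbove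
  exact ⟨N+1, fun l hl => Nat.lt_succ_of_le (hN ⟨l, hl, rfl⟩)⟩

theorem advRun_len (G : List Bool → FinDigraph) (A : FinDigraph) (j : ℕ) :
    (advRunBR G A j).length = j := by
  induction j with
  | zero => rfl
  | succ j ih => simp [advRunBR, ih]

/-- the class of finite digraphs having an oriented cycle with non-zero
net length is decided by an adaptive right unbounded query algorithm over 𝔹, but not
by any adaptive right `k`-query algorithm over 𝔹. -/
theorem stmt18 :
    (∃ G : List Bool → FinDigraph ⊕ Bool,
      UDecidesR G {A : FinDigraph | ∃ W : OWalk A, W.IsCycle ∧ W.netLength ≠ 0}) ∧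
    (∀ (k : ℕ) (G : List Bool → FinDigraph) (X : Set (List Bool)),
      ¬ ∀ A : FinDigraph,
        ((∃ W : OWalk A, W.IsCycle ∧ W.netLength ≠ 0) ↔ advRunBR G A k ∈ X)) := by
  refine ⟨⟨algR, algR_decides⟩, ?_⟩
  intro k G X hX
  obtain ⟨N, hN⟩ := exists_bound k G
  obtain ⟨M, hM⟩ : ∃ M, N.factorial = M + 1 :=
    ⟨N.factorial - 1, by have := Nat.factorial_pos N; omega⟩
  have hrun : ∀ j ≤ k, advRunBR G (dcyc (M+1)) j = advRunBR G (dpath N) j := by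
    intro j
    induction j with
    | zero => intro _; rfl
    | succ j ih =>
      intro hj
      have ih := ih (by omega)
      simp only [advRunBR]
      rw [ih, homB_same _ N M (hN _ (by rw [advRun_len]; omega)) hM]
  have h1 := (hX (dcyc (M+1))).1 (hasCyc_dcyc M)
  rw [hrun k le_rfl] at h1
  exact not_hasCyc_dpath N ((hX (dpath N)).2 h1)
end

section
/- Let k ≥ 1 and consider finite structures with signature consisting of k unary relation symbols, i.e. pairs (V, (P_1, …, P_k)) with V a finite set and each P_i ⊆ V. Every class of such structures that is closed under isomorphism is decided by a non-adaptive left 2^k-query algorithm over ℕ. -/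
/-- A finite structure with `k` unary predicates: a nonempty domain `Fin card`
together with predicates `P i`. -/
structure UStruct (k : ℕ) where
  card : ℕ
  pos : 0 < card
  P : Fin k → Fin card → Prop

/-- `f` is a homomorphism of unary structures from `A` to `B`. -/
def IsHomU {k : ℕ} (A B : UStruct k) (f : Fin A.card → Fin B.card) : Prop :=
  ∀ (i : Fin k) (a : Fin A.card), A.P i a → B.P i (f a)

/-- The number of homomorphisms from `A` to `B`. -/
noncomputable def homU {k : ℕ} (A B : UStruct k) : ℕ :=
  Nat.card {f : Fin A.card → Fin B.card // IsHomU A B f}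

/-- Isomorphism of unary structures. -/
def IsoU {k : ℕ} (A B : UStruct k) : Prop :=
  ∃ e : Fin A.card ≃ Fin B.card, ∀ (i : Fin k) (a : Fin A.card), A.P i a ↔ B.P i (e a)

open Classical in
noncomputable def utype {k : ℕ} (A : UStruct k) (a : Fin A.card) : Finset (Fin k) :=
  Finset.univ.filter (fun i => A.P i a)

def usingle {k : ℕ} (S : Finset (Fin k)) : UStruct k := ⟨1, one_pos, fun i _ => i ∈ S⟩

theorem homU_usingle {k : ℕ} (S : Finset (Fin k)) (A : UStruct k) :
    homU (usingle S) A = (Finset.univ.filter (fun a => S ⊆ utype A a)).card := by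
  classical
  rw [homU, ← Fintype.card_subtype, ← Nat.card_eq_fintype_card]
  refine Nat.card_congr ?_
  refine Equiv.subtypeEquiv (Equiv.funUnique (Fin 1) (Fin A.card)) ?_
  intro f
  constructor
  · intro h i hi
    exact Finset.mem_filter.2 ⟨Finset.mem_univ _, h i (0 : Fin 1) hi⟩
  · intro h i a hi
    have h2 : A.P i (f (0 : Fin 1)) := (Finset.mem_filter.1 (h hi)).2
    have : a = (0 : Fin 1) := Subsingleton.elim (α := Fin 1) _ _
    rw [this]; exact h2

theorem card_split {k : ℕ} (S : Finset (Fin k)) (A : UStruct k) :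
    (Finset.univ.filter (fun a => S ⊆ utype A a)).card =
      (Finset.univ.filter (fun a => utype A a = S)).card +
      ∑ T ∈ Finset.univ.filter (fun T => S ⊂ T),
        (Finset.univ.filter (fun a => utype A a = T)).card := by
  classical
  rw [Finset.card_eq_sum_card_fiberwise (f := utype A)
    (t := insert S (Finset.univ.filter (fun T => S ⊂ T)))]
  · rw [Finset.sum_insert (by simp)]
    congr 1
    · congr 1; ext a; simp; rintro rfl; simp
    · refine Finset.sum_congr rfl ?_
      intro T hT
      have hT' : S ⊂ T := by simpa using hT
      congr 1; ext a; simp; rintro rfl; exact hT'.subset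
  · intro a ha
    have ha' : S ⊆ utype A a := by simpa using ha
    rcases ha'.eq_or_ssubset with h | h
    · simp [← h]
    · simp [h]

theorem iso_of_homs {k : ℕ} (A B : UStruct k)
    (h : ∀ S, homU (usingle S) A = homU (usingle S) B) : IsoU A B := by
  classical
  have key : ∀ n : ℕ, ∀ S : Finset (Fin k), k - S.card = n →
      (Finset.univ.filter (fun a => utype A a = S)).card =
      (Finset.univ.filter (fun a => utype B a = S)).card := by
    intro n
    induction n using Nat.strong_induction_on with
    | _ n ih =>
      intro S hS
      have h1 := h S
      rw [homU_usingle, homU_usingle, card_split, card_split] at h1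
      have h2 : ∑ T ∈ Finset.univ.filter (fun T => S ⊂ T),
          (Finset.univ.filter (fun a => utype A a = T)).card =
          ∑ T ∈ Finset.univ.filter (fun T => S ⊂ T),
          (Finset.univ.filter (fun a => utype B a = T)).card := by
        refine Finset.sum_congr rfl ?_
        intro T hT
        have hT' : S ⊂ T := by simpa using hT
        have := Finset.card_lt_card hT'
        have h3 : T.card ≤ k := by simpa using Finset.card_le_univ T
        exact ih (k - T.card) (by omega) T rfl
      omega
  have e : ∀ S, Nonempty ({a // utype A a = S} ≃ {b // utype B b = S}) := by
    intro S
    refine ⟨Fintype.equivOfCardEq ?_⟩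
    rw [Fintype.card_subtype, Fintype.card_subtype]
    exact key _ S rfl
  replace e := fun S => (e S).some
  let E : Fin A.card ≃ Fin B.card :=
    ((Equiv.sigmaFiberEquiv (utype A)).symm.trans (Equiv.sigmaCongrRight e)).trans
      (Equiv.sigmaFiberEquiv (utype B))
  have hE : ∀ a, utype B (E a) = utype A a := by
    intro a
    exact (e (utype A a) ⟨a, rfl⟩).2
  refine ⟨E, fun i a => ?_⟩
  have := Finset.ext_iff.1 (hE a) i
  simpa [utype] using this.symm

theorem stmt19 (k : ℕ) (hk : 1 ≤ k) (C : Set (UStruct k))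
    (hC : ∀ A B : UStruct k, IsoU A B → (A ∈ C ↔ B ∈ C)) :
    ∃ (F : Fin (2 ^ k) → UStruct k) (X : Set (Fin (2 ^ k) → ℕ)),
      ∀ A : UStruct k, A ∈ C ↔ (fun i => homU (F i) A) ∈ X := by
  let g : Fin (2 ^ k) ≃ Finset (Fin k) := Fintype.equivOfCardEq (by simp)
  refine ⟨fun i => usingle (g i),
    (fun A i => homU (usingle (g i)) A) '' C, fun A => ⟨fun h => ⟨A, h, rfl⟩, ?_⟩⟩
  rintro ⟨B, hB, hBA⟩
  refine (hC B A (iso_of_homs B A fun S => ?_)).1 hB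
  simpa using congrFun hBA (g.symm S)
end
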